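/- Let μ ∈ ℝ, σ > 0, p ∈ (0,1), α > 0, let f be the GAL(μ,σ,p,α) density, and let m = μ + √(2/π)·ασ + σ(1−2p)/(p(1−p)) be its mean. Then the third central moment satisfies ∫_ℝ (y − m)³ f(y) dy = α³σ³·√(2/π)·(4/π − 1) + 2σ³·((1−p)³ − p³)/(p³(1−p)³). -/

import Mathlib

open MeasureTheory Real Set

/-- Standard normal CDF. -/
noncomputable def Phi (x : ℝ) : ℝ :=
  ∫ t in Set.Iic x, (Real.sqrt (2 * Real.pi))⁻¹ * Real.exp (-t ^ 2 / 2)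

/-- The GAL(μ,σ,p,α) probability density function. -/
noncomputable def galPdf (μ σ p α y : ℝ) : ℝ :=
  let ys := (y - μ) / σ
  let pp := p - (if 0 < α then 1 else 0)
  let pm := p - (if α < 0 then 1 else 0)
  (2 * p * (1 - p) / σ) *
    ((Phi (ys / α - α * pm) - Phi (-(α * pm))) *
        Real.exp (-(ys * pm) + (α * pm) ^ 2 / 2) *
        (if 0 < ys / α then 1 else 0) +
      Phi (α * pp - ys / α * (if 0 < ys / α then 1 else 0)) *
        Real.exp (-(ys * pp) + (α * pp) ^ 2 / 2))


/-- The density of `α * |Z|` for a standard normal `Z`. -/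
noncomputable def halfNormalPdf (α t : ℝ) : ℝ :=
  (Ioi 0).indicator (fun t => 2 / α * ((√(2 * π))⁻¹ * exp (-(t / α) ^ 2 / 2))) t

/-- The density of the asymmetric Laplace distribution with quantile level `p`. -/
noncomputable def asymLaplacePdf (p u : ℝ) : ℝ :=
  p * (1 - p) * ((Ici 0).indicator (fun u => exp (-(p * u))) u +
    (Iio 0).indicator (fun u => exp ((1 - p) * u)) u)

section Convolution

variable {f g : ℝ → ℝ}

lemma integrable_central_moment_of_raw (hf : ∀ j : ℕ, Integrable fun t => t ^ j * f t) (a : ℝ)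
    (j : ℕ) : Integrable fun t => (t - a) ^ j * f t := by
  induction j with
  | zero => simpa using hf 0
  | succ j ih =>
    have h : ∀ i k : ℕ, Integrable fun t => t ^ i * ((t - a) ^ k * f t) := by
      intro i k
      induction k generalizing i with
      | zero => simpa using hf i
      | succ k ihk =>
        refine ((ihk (i + 1)).sub ((ihk i).const_mul a)).congr (.of_forall fun t => ?_)
        simp only [Pi.sub_apply]
        ring
    simpa using h 0 (j + 1)

lemma integral_prod_convolution (hf : Integrable f) (hg : Integrable g) :
    Integrable (fun z : ℝ × ℝ => f z.2 * g (z.1 - z.2)) (volume.prod volume) ∧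
      ∫ z : ℝ × ℝ, f z.2 * g (z.1 - z.2) ∂(volume.prod volume) = (∫ t, f t) * ∫ u, g u := by
  have hi : Integrable (fun z : ℝ × ℝ => f z.2 * g (z.1 - z.2)) (volume.prod volume) :=
    hf.convolution_integrand (ContinuousLinearMap.mul ℝ ℝ) hg
  refine ⟨hi, ?_⟩
  rw [integral_prod _ hi]
  exact integral_convolution (ContinuousLinearMap.mul ℝ ℝ) hf hg

/-- Third central moments are additive under convolution of centered densities. -/
lemma integral_cube_mul_convolution (hf : ∀ j : ℕ, Integrable fun t => t ^ j * f t)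
    (hg : ∀ j : ℕ, Integrable fun t => t ^ j * g t) {a b : ℝ}
    (hf0 : ∫ t, f t = 1) (hg0 : ∫ t, g t = 1)
    (hf1 : ∫ t, (t - a) ^ 1 * f t = 0) (hg1 : ∫ t, (t - b) ^ 1 * g t = 0) :
    ∫ x, (x - (a + b)) ^ 3 * ∫ t, f t * g (x - t) =
      (∫ t, (t - a) ^ 3 * f t) + ∫ t, (t - b) ^ 3 * g t := by
  have F := integrable_central_moment_of_raw hf a
  have G := integrable_central_moment_of_raw hg b
  obtain ⟨i30, e30⟩ := integral_prod_convolution (F 3) (G 0)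
  obtain ⟨i21, e21⟩ := integral_prod_convolution (F 2) (G 1)
  obtain ⟨i12, e12⟩ := integral_prod_convolution (F 1) (G 2)
  obtain ⟨i03, e03⟩ := integral_prod_convolution (F 0) (G 3)
  have expand : ∀ x t, (x - (a + b)) ^ 3 * (f t * g (x - t)) =
      (t - a) ^ 3 * f t * ((x - t - b) ^ 0 * g (x - t)) +
      3 * ((t - a) ^ 2 * f t * ((x - t - b) ^ 1 * g (x - t))) +
      3 * ((t - a) ^ 1 * f t * ((x - t - b) ^ 2 * g (x - t))) +
      (t - a) ^ 0 * f t * ((x - t - b) ^ 3 * g (x - t)) := by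
    intro x t
    ring
  have i1 := i30.fun_add (i21.const_mul 3)
  have i2 := i1.fun_add (i12.const_mul 3)
  simp_rw [← integral_const_mul, expand]
  rw [← integral_prod (fun z : ℝ × ℝ =>
      (z.2 - a) ^ 3 * f z.2 * ((z.1 - z.2 - b) ^ 0 * g (z.1 - z.2)) +
      3 * ((z.2 - a) ^ 2 * f z.2 * ((z.1 - z.2 - b) ^ 1 * g (z.1 - z.2))) +
      3 * ((z.2 - a) ^ 1 * f z.2 * ((z.1 - z.2 - b) ^ 2 * g (z.1 - z.2))) +
      (z.2 - a) ^ 0 * f z.2 * ((z.1 - z.2 - b) ^ 3 * g (z.1 - z.2))) (i2.fun_add i03)]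
  rw [integral_add i2 i03, integral_add i1 (i12.const_mul 3),
    integral_add i30 (i21.const_mul 3), integral_const_mul, integral_const_mul,
    e30, e21, e12, e03, hf1, hg1]
  simp [hf0, hg0]

lemma integral_sub_pow_one_mul (hf : ∀ j : ℕ, Integrable fun t => t ^ j * f t) (a : ℝ) :
    ∫ t, (t - a) ^ 1 * f t = (∫ t, t ^ 1 * f t) - a * ∫ t, t ^ 0 * f t := by
  rw [← integral_const_mul, ← integral_sub (hf 1) ((hf 0).const_mul a)]
  congr 1 with t
  ring

lemma integral_sub_pow_three_mul (hf : ∀ j : ℕ, Integrable fun t => t ^ j * f t) (a : ℝ) :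
    ∫ t, (t - a) ^ 3 * f t = (∫ t, t ^ 3 * f t) - 3 * a * (∫ t, t ^ 2 * f t) +
      3 * a ^ 2 * (∫ t, t ^ 1 * f t) - a ^ 3 * ∫ t, t ^ 0 * f t := by
  have i1 := (hf 3).sub' ((hf 2).const_mul (3 * a))
  have i2 := i1.fun_add ((hf 1).const_mul (3 * a ^ 2))
  rw [← integral_const_mul, ← integral_const_mul, ← integral_const_mul,
    ← integral_sub (hf 3) ((hf 2).const_mul _), ← integral_add i1 ((hf 1).const_mul _),
    ← integral_sub i2 ((hf 0).const_mul _)]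
  congr 1 with t
  ring

end Convolution

section HalfNormal

variable {α : ℝ}

lemma halfNormalPdf_moment (hα : 0 < α) (j : ℕ) :
    Integrable (fun t => t ^ j * halfNormalPdf α t) ∧
      ∫ t, t ^ j * halfNormalPdf α t =
        (√2 * α) ^ j * Real.Gamma ((j + 1) / 2) / √π := by
  have hb : 0 < 1 / (2 * α ^ 2) := by positivity
  have hj : (-1 : ℝ) < j := by linarith [j.cast_nonneg (α := ℝ)]
  have heq : (fun t => t ^ j * halfNormalPdf α t) = (Ioi 0).indicator
      (fun t => 2 / α * (√(2 * π))⁻¹ *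
        (t ^ (j : ℝ) * exp (-(1 / (2 * α ^ 2)) * t ^ (2 : ℝ)))) := by
    ext t
    by_cases ht : t ∈ Ioi (0 : ℝ)
    · simp only [halfNormalPdf, indicator_of_mem ht, rpow_natCast, rpow_two]
      rw [show -(t / α) ^ 2 / 2 = -(1 / (2 * α ^ 2)) * t ^ 2 by field_simp]
      ring
    · simp [halfNormalPdf, indicator_of_notMem ht]
  rw [heq]
  refine ⟨IntegrableOn.integrable_indicator
    ((integrableOn_rpow_mul_exp_neg_mul_rpow hj two_pos hb).const_mul _) measurableSet_Ioi, ?_⟩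
  rw [integral_indicator measurableSet_Ioi, integral_const_mul,
    integral_rpow_mul_exp_neg_mul_rpow two_pos hj hb]
  have hs : 0 < √2 * α := by positivity
  have hbase : 1 / (2 * α ^ 2) = (√2 * α) ^ (-2 : ℝ) := by
    rw [rpow_neg hs.le, rpow_two, mul_pow, sq_sqrt zero_le_two, one_div]
  rw [hbase, ← rpow_mul hs.le, show (-2 : ℝ) * (-(j + 1) / 2) = ((j + 1 : ℕ) : ℝ) by
    push_cast; ring, rpow_natCast, sqrt_mul zero_le_two]
  have : √2 ≠ 0 := by positivity
  have : √π ≠ 0 := by positivity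
  field_simp
  ring

lemma sqrt_two_div_pi : √(2 / π) = √2 / √π := sqrt_div zero_le_two π

lemma integral_halfNormalPdf (hα : 0 < α) : ∫ t, t ^ 0 * halfNormalPdf α t = 1 := by
  rw [(halfNormalPdf_moment hα 0).2]
  have : √π ≠ 0 := by positivity
  have h := Real.Gamma_one_half_eq
  rw [one_div] at h
  simp [h, this]

lemma halfNormalPdf_mean (hα : 0 < α) : ∫ t, t ^ 1 * halfNormalPdf α t = √(2 / π) * α := by
  rw [(halfNormalPdf_moment hα 1).2, sqrt_two_div_pi]
  norm_num
  ring

lemma halfNormalPdf_second_moment (hα : 0 < α) :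
    ∫ t, t ^ 2 * halfNormalPdf α t = α ^ 2 := by
  rw [(halfNormalPdf_moment hα 2).2, show ((2 : ℕ) + 1 : ℝ) / 2 = 1 / 2 + 1 by norm_num,
    Real.Gamma_add_one (by norm_num), Real.Gamma_one_half_eq, mul_pow, sq_sqrt zero_le_two]
  have : √π ≠ 0 := by positivity
  field_simp

lemma halfNormalPdf_third_moment (hα : 0 < α) :
    ∫ t, t ^ 3 * halfNormalPdf α t = 2 * √(2 / π) * α ^ 3 := by
  rw [(halfNormalPdf_moment hα 3).2, show ((3 : ℕ) + 1 : ℝ) / 2 = 1 + 1 by norm_num,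
    Real.Gamma_add_one (by norm_num), Real.Gamma_one, mul_pow, pow_succ √2 2,
    sq_sqrt zero_le_two, sqrt_two_div_pi]
  ring

end HalfNormal

section AsymLaplace

lemma moment_exp_Ioi {r : ℝ} (hr : 0 < r) (j : ℕ) :
    IntegrableOn (fun u : ℝ => u ^ j * exp (-(r * u))) (Ioi 0) ∧
      ∫ u in Ioi (0 : ℝ), u ^ j * exp (-(r * u)) = j.factorial / r ^ (j + 1) := by
  have hj : (-1 : ℝ) < j := by linarith [j.cast_nonneg (α := ℝ)]
  have h1 := integrableOn_rpow_mul_exp_neg_mul_rpow hj one_pos hr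
  have h2 := integral_rpow_mul_exp_neg_mul_rpow one_pos hj hr
  simp only [rpow_natCast, rpow_one, neg_mul] at h1 h2
  refine ⟨h1, ?_⟩
  rw [h2, div_one, div_one, div_one, mul_one, Real.Gamma_nat_eq_factorial, rpow_neg hr.le,
    show (j + 1 : ℝ) = ((j + 1 : ℕ) : ℝ) by push_cast; rfl, rpow_natCast]
  ring

lemma moment_exp_Iio {r : ℝ} (hr : 0 < r) (j : ℕ) :
    IntegrableOn (fun u : ℝ => u ^ j * exp (r * u)) (Iio 0) ∧
      ∫ u in Iio (0 : ℝ), u ^ j * exp (r * u) = (-1) ^ j * j.factorial / r ^ (j + 1) := by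
  obtain ⟨h1, h2⟩ := moment_exp_Ioi hr j
  have heq : (fun u : ℝ => u ^ j * exp (r * u)) =
      fun u => (-1) ^ j * ((-u) ^ j * exp (-(r * -u))) := by
    ext u
    rw [← mul_assoc, ← mul_pow]
    simp
  rw [heq, integral_const_mul, ← integral_Iic_eq_integral_Iio,
    integral_comp_neg_Iic 0 (fun u : ℝ => u ^ j * exp (-(r * u))), neg_zero, h2]
  refine ⟨Integrable.const_mul ?_ _, by ring⟩
  rw [← neg_zero] at h1
  exact h1.comp_neg_Iio

lemma asymLaplacePdf_moment {p : ℝ} (hp : p ∈ Ioo (0 : ℝ) 1) (j : ℕ) :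
    Integrable (fun u => u ^ j * asymLaplacePdf p u) ∧
      ∫ u, u ^ j * asymLaplacePdf p u = p * (1 - p) *
        (j.factorial / p ^ (j + 1) + (-1) ^ j * j.factorial / (1 - p) ^ (j + 1)) := by
  obtain ⟨i1, e1⟩ := moment_exp_Ioi hp.1 j
  obtain ⟨i2, e2⟩ := moment_exp_Iio (sub_pos.2 hp.2) j
  rw [← integrableOn_Ici_iff_integrableOn_Ioi] at i1
  rw [← integral_Ici_eq_integral_Ioi, ← integral_indicator measurableSet_Ici] at e1
  rw [← integral_indicator measurableSet_Iio] at e2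
  replace i1 := i1.integrable_indicator measurableSet_Ici
  replace i2 := i2.integrable_indicator measurableSet_Iio
  have heq : (fun u => u ^ j * asymLaplacePdf p u) = fun u => p * (1 - p) *
      ((Ici 0).indicator (fun u : ℝ => u ^ j * exp (-(p * u))) u +
        (Iio 0).indicator (fun u : ℝ => u ^ j * exp ((1 - p) * u)) u) := by
    ext u
    simp only [asymLaplacePdf, indicator_apply]
    split_ifs <;> ring
  rw [heq, integral_const_mul, integral_add i1 i2, e1, e2]
  exact ⟨(i1.add i2).const_mul _, rfl⟩

end AsymLaplace

section Density

lemma integrable_stdNormal : Integrable fun t : ℝ => (√(2 * π))⁻¹ * exp (-t ^ 2 / 2) := by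
  have h := (integrable_exp_neg_mul_sq (b := 1 / 2) (by norm_num)).const_mul (√(2 * π))⁻¹
  refine h.congr (.of_forall fun t => ?_)
  ring_nf

lemma Phi_neg (x : ℝ) : Phi (-x) = 1 - Phi x := by
  have h1 : Phi (-x) = ∫ t in Ioi x, (√(2 * π))⁻¹ * exp (-t ^ 2 / 2) := by
    rw [Phi, ← integral_comp_neg_Ioi]
    simp
  have h2 : ∫ t : ℝ, (√(2 * π))⁻¹ * exp (-t ^ 2 / 2) = 1 := by
    rw [integral_const_mul]
    have := integral_gaussian (1 / 2)
    rw [show π / (1 / 2) = 2 * π by ring] at this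
    rw [show (fun t : ℝ => exp (-t ^ 2 / 2)) = fun t => exp (-(1 / 2) * t ^ 2) by
      ext t; ring_nf, this]
    exact inv_mul_cancel₀ (by positivity)
  rw [h1, Phi, ← h2, ← intervalIntegral.integral_Iic_add_Ioi (b := x)
    integrable_stdNormal.integrableOn integrable_stdNormal.integrableOn]
  ring

/-- Gaussian tail integral with an exponential tilt, by completing the square. -/
lemma integral_Ioi_gaussian_tilt {α : ℝ} (hα : 0 < α) (r a : ℝ) :
    IntegrableOn (fun t => (√(2 * π))⁻¹ * exp (-(t / α) ^ 2 / 2 + r * t)) (Ioi a) ∧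
      ∫ t in Ioi a, (√(2 * π))⁻¹ * exp (-(t / α) ^ 2 / 2 + r * t) =
        α * exp ((α * r) ^ 2 / 2) * Phi (α * r - a / α) := by
  set φ : ℝ → ℝ := fun t => (√(2 * π))⁻¹ * exp (-t ^ 2 / 2) with hφ
  have heq : (fun t => (√(2 * π))⁻¹ * exp (-(t / α) ^ 2 / 2 + r * t)) =
      fun t => exp ((α * r) ^ 2 / 2) * φ (α * r - t / α) := by
    ext t
    rw [hφ, mul_left_comm, ← exp_add]
    congr 2
    field_simp
    ring
  have hi : Integrable fun t => φ (α * r - t / α) :=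
    (integrable_stdNormal.comp_sub_left (α * r)).comp_div hα.ne'
  rw [heq]
  refine ⟨(hi.const_mul _).integrableOn, ?_⟩
  have hind : (Ioi a).indicator (fun t => φ (α * r - t / α)) =
      fun t => (Iio (α * r - a / α)).indicator φ (α * r - t / α) := by
    ext t
    simp only [indicator_apply, mem_Ioi, mem_Iio, sub_lt_sub_iff_left,
      div_lt_div_iff_of_pos_right hα]
  rw [integral_const_mul, ← integral_indicator measurableSet_Ioi, hind,
    Measure.integral_comp_div (fun s => (Iio (α * r - a / α)).indicator φ (α * r - s)),
    integral_sub_left_eq_self, integral_indicator measurableSet_Iio,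
    ← integral_Iic_eq_integral_Iio, abs_of_pos hα, Phi, smul_eq_mul]
  ring

lemma galPdf_zero_one_eq_convolution {p α : ℝ} (hα : 0 < α) (x : ℝ) :
    galPdf 0 1 p α x = ∫ t, halfNormalPdf α t * asymLaplacePdf p (x - t) := by
  set E : ℝ → ℝ → ℝ := fun r t => (√(2 * π))⁻¹ * exp (-(t / α) ^ 2 / 2 + r * t) with hE
  have hfac : ∀ r t, exp (-(t / α) ^ 2 / 2) * exp (-(r * (x - t))) =
      exp (-(r * x)) * exp (-(t / α) ^ 2 / 2 + r * t) := by
    intro r t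
    rw [← exp_add, ← exp_add]
    ring_nf
  have hpoint : ∀ t, halfNormalPdf α t * asymLaplacePdf p (x - t) =
      2 / α * (p * (1 - p)) * (exp (-(p * x)) *
          ((Ioi 0).indicator (E p) t - (Ioi (max x 0)).indicator (E p) t) +
        exp (-((p - 1) * x)) * (Ioi (max x 0)).indicator (E (p - 1)) t) := by
    intro t
    have h1 := hfac p t
    have h2 := hfac (p - 1) t
    rw [show -((p - 1) * (x - t)) = (1 - p) * (x - t) by ring] at h2
    simp only [halfNormalPdf, asymLaplacePdf, indicator_apply, mem_Ioi, mem_Ici, mem_Iio,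
      max_lt_iff, sub_nonneg, sub_neg]
    by_cases ht : 0 < t
    · rcases le_or_gt t x with htx | htx
      · simp only [ht, htx, htx.not_gt, if_true, if_false, and_true, hE]
        linear_combination 2 / α * (p * (1 - p)) * (√(2 * π))⁻¹ * h1
      · simp only [ht, htx, htx.not_ge, if_true, if_false, and_self, hE]
        linear_combination 2 / α * (p * (1 - p)) * (√(2 * π))⁻¹ * h2
    · simp [ht]
  simp_rw [hpoint]
  obtain ⟨i1, e1⟩ := integral_Ioi_gaussian_tilt hα p 0
  obtain ⟨i2, e2⟩ := integral_Ioi_gaussian_tilt hα p (max x 0)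
  obtain ⟨i3, e3⟩ := integral_Ioi_gaussian_tilt hα (p - 1) (max x 0)
  rw [← integral_indicator measurableSet_Ioi] at e1 e2 e3
  replace i1 : Integrable ((Ioi 0).indicator (E p)) := i1.integrable_indicator measurableSet_Ioi
  replace i2 : Integrable ((Ioi (max x 0)).indicator (E p)) :=
    i2.integrable_indicator measurableSet_Ioi
  replace i3 : Integrable ((Ioi (max x 0)).indicator (E (p - 1))) :=
    i3.integrable_indicator measurableSet_Ioi
  rw [integral_const_mul, integral_add ((i1.sub' i2).const_mul _) (i3.const_mul _),
    integral_const_mul, integral_const_mul, integral_sub i1 i2, e1, e2, e3]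
  have hα' : ¬ α < 0 := hα.not_gt
  simp only [galPdf, hα, hα', if_true, if_false, sub_zero, div_one, zero_div, exp_add]
  have hdiv : (0 < x / α) ↔ 0 < x := div_pos_iff_of_pos_right hα
  rw [show -(x * p) = -(p * x) by ring, show -(x * (p - 1)) = -((p - 1) * x) by ring]
  by_cases hx : 0 < x
  · simp only [hdiv, hx, if_true, max_eq_left hx.le, mul_one]
    rw [show x / α - α * p = -(α * p - x / α) by ring, Phi_neg, Phi_neg]
    field_simp
    ring
  · simp only [hdiv, hx, if_false, max_eq_right (not_lt.1 hx), mul_zero, sub_self, zero_div,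
      sub_zero, zero_add]
    field_simp

lemma galPdf_eq_standardized {σ : ℝ} (μ p α y : ℝ) :
    galPdf μ σ p α y = σ⁻¹ * galPdf 0 1 p α ((y - μ) / σ) := by
  simp only [galPdf, sub_zero, div_one]
  ring

end Density

/-- The third central moment of the GAL distribution. -/
theorem gal_third_central_moment (μ σ p α : ℝ) (hσ : 0 < σ)
    (hp : p ∈ Set.Ioo (0 : ℝ) 1) (hα : 0 < α) :
    (∫ y : ℝ,
        (y - (μ + Real.sqrt (2 / Real.pi) * α * σ + σ * (1 - 2 * p) / (p * (1 - p)))) ^ 3 *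
          galPdf μ σ p α y) =
      α ^ 3 * σ ^ 3 * Real.sqrt (2 / Real.pi) * (4 / Real.pi - 1) +
        2 * σ ^ 3 * ((1 - p) ^ 3 - p ^ 3) / (p ^ 3 * (1 - p) ^ 3) := by
  have hp0 : p ≠ 0 := hp.1.ne'
  have hp1 : 1 - p ≠ 0 := (sub_pos.2 hp.2).ne'
  set a := √(2 / π) * α with ha
  set b := (1 - 2 * p) / (p * (1 - p)) with hb
  have hf := fun j => (halfNormalPdf_moment hα j).1
  have hg := fun j => (asymLaplacePdf_moment hp j).1
  have hg0 : ∫ u, u ^ 0 * asymLaplacePdf p u = 1 := by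
    rw [(asymLaplacePdf_moment hp 0).2]
    simp
    field_simp
    ring
  have hg1 : ∫ u, u ^ 1 * asymLaplacePdf p u = b := by
    rw [(asymLaplacePdf_moment hp 1).2, hb]
    simp
    field_simp
    ring
  have hfc1 : ∫ t, (t - a) ^ 1 * halfNormalPdf α t = 0 := by
    rw [integral_sub_pow_one_mul hf, halfNormalPdf_mean hα, integral_halfNormalPdf hα]
    ring
  have hgc1 : ∫ u, (u - b) ^ 1 * asymLaplacePdf p u = 0 := by
    rw [integral_sub_pow_one_mul hg, hg1, hg0]
    ring
  have hfc3 : ∫ t, (t - a) ^ 3 * halfNormalPdf α t = α ^ 3 * √(2 / π) * (4 / π - 1) := by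
    have hs : √(2 / π) ^ 2 = 2 / π := sq_sqrt (by positivity)
    rw [integral_sub_pow_three_mul hf, halfNormalPdf_mean hα, integral_halfNormalPdf hα,
      halfNormalPdf_second_moment hα, halfNormalPdf_third_moment hα, ha]
    linear_combination 2 * α ^ 3 * √(2 / π) * hs
  have hgc3 : ∫ u, (u - b) ^ 3 * asymLaplacePdf p u =
      2 * ((1 - p) ^ 3 - p ^ 3) / (p ^ 3 * (1 - p) ^ 3) := by
    rw [integral_sub_pow_three_mul hg, hg1, hg0, (asymLaplacePdf_moment hp 2).2,
      (asymLaplacePdf_moment hp 3).2, hb]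
    simp [Nat.factorial]
    field_simp
    ring
  have key := integral_cube_mul_convolution hf hg
    (by simpa using integral_halfNormalPdf hα) (by simpa using hg0) hfc1 hgc1
  simp_rw [← galPdf_zero_one_eq_convolution hα] at key
  have hscale : ∀ y, (y - (μ + a * σ + σ * (1 - 2 * p) / (p * (1 - p)))) ^ 3 *
      galPdf μ σ p α y =
      σ ^ 2 * (((y - μ) / σ - (a + b)) ^ 3 * galPdf 0 1 p α ((y - μ) / σ)) := by
    intro y
    rw [galPdf_eq_standardized, hb]
    field_simp
    ring
  simp_rw [hscale]
  rw [integral_const_mul, integral_sub_right_eq_self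
      (fun z => (z / σ - (a + b)) ^ 3 * galPdf 0 1 p α (z / σ)) μ,
    Measure.integral_comp_div (fun z => (z - (a + b)) ^ 3 * galPdf 0 1 p α z) σ, key, hfc3, hgc3,
    abs_of_pos hσ, smul_eq_mul]
  ring
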